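/- arXiv:2402.17031 — 3 statements merged into one kernel-verified Lean document; each statement's English description precedes it below -/
import Mathlib

section
/- In the stationary ergodic environment setting, let β ≥ 0, G ∈ 𝒢_sqc with monotonicity constant η > 0, and let λ₂ > λ₁ ≥ β. Set R := max{−G_−^{-1}(λ₂), G_+^{-1}(λ₂)} and let C_R be a Lipschitz constant of G on [−R,R]. For λ ∈ {λ₁,λ₂} let u₊^λ(·,ω) and u₋^λ(·,ω) denote, for each ω, the unique elements of 𝒮^λ_+(ω) and 𝒮^λ_−(ω) vanishing at 0. Then there exists an event Ω̂ with ℙ(Ω̂) = 1 such that for every ω ∈ Ω̂: (i) (λ₂−λ₁)/C_R ≤ ∂_x u₊^{λ₂}(x,ω) − ∂_x u₊^{λ₁}(x,ω) ≤ (λ₂−λ₁)/η for a.e. x ∈ ℝ; (ii) (λ₂−λ₁)/C_R ≤ ∂_x u₋^{λ₁}(x,ω) − ∂_x u₋^{λ₂}(x,ω) ≤ (λ₂−λ₁)/η for a.e. x ∈ ℝ. -/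
open Real Set MeasureTheory

noncomputable section

/-- The class 𝒢(α₀,α₁,γ): growth condition (G1) and local Lipschitz condition (G2). -/
def MemG (α₀ α₁ γ : ℝ) (G : ℝ → ℝ) : Prop :=
  (∀ p : ℝ, α₀ * |p| ^ γ - 1 / α₀ ≤ G p ∧ G p ≤ α₁ * (|p| ^ γ + 1)) ∧
  (∀ p q : ℝ, |G p - G q| ≤ α₁ * (|p| + |q| + 1) ^ (γ - 1) * |p - q|)

/-- The class 𝒢: union of the classes 𝒢(α₀,α₁,γ). -/
def MemGclass (G : ℝ → ℝ) : Prop :=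
  ∃ α₀ α₁ γ : ℝ, 0 < α₀ ∧ 0 < α₁ ∧ 1 < γ ∧ MemG α₀ α₁ γ G

/-- Condition (G4): strict monotonicity with rate η on both half-lines. -/
def StrictIncrRate (G : ℝ → ℝ) (η : ℝ) : Prop :=
  ∀ p₁ p₂ : ℝ, 0 ≤ p₁ → p₁ < p₂ →
    η * (p₂ - p₁) ≤ G p₂ - G p₁ ∧ η * (p₂ - p₁) ≤ G (-p₂) - G (-p₁)

/-- The class 𝒢_sqc: G ∈ 𝒢, G(0) = 0 and (G4) for some η > 0. -/
def MemGsqc (G : ℝ → ℝ) : Prop :=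
  MemGclass G ∧ G 0 = 0 ∧ ∃ η : ℝ, 0 < η ∧ StrictIncrRate G η

/-- G_+^{-1} : the inverse of the restriction of G to [0,∞). -/
def GplusInv (G : ℝ → ℝ) (y : ℝ) : ℝ := Function.invFunOn G (Set.Ici 0) y

/-- G_−^{-1} : the inverse of the restriction of G to (−∞,0]. -/
def GminusInv (G : ℝ → ℝ) (y : ℝ) : ℝ := Function.invFunOn G (Set.Iic 0) y

/-- Viscosity subsolution of a(x)u'' + G(u') + βV(x) = λ on ℝ. -/
def IsViscSubsol (a V G : ℝ → ℝ) (β lam : ℝ) (u : ℝ → ℝ) : Prop :=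
  ∀ x₀ : ℝ, ∀ φ : ℝ → ℝ, ContDiff ℝ 2 φ →
    IsLocalMax (fun x => u x - φ x) x₀ →
    lam ≤ a x₀ * deriv (deriv φ) x₀ + G (deriv φ x₀) + β * V x₀

/-- Viscosity supersolution of a(x)u'' + G(u') + βV(x) = λ on ℝ. -/
def IsViscSupersol (a V G : ℝ → ℝ) (β lam : ℝ) (u : ℝ → ℝ) : Prop :=
  ∀ x₀ : ℝ, ∀ φ : ℝ → ℝ, ContDiff ℝ 2 φ →
    IsLocalMin (fun x => u x - φ x) x₀ →
    a x₀ * deriv (deriv φ) x₀ + G (deriv φ x₀) + β * V x₀ ≤ lam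

/-- Continuous viscosity solution of a(x)u'' + G(u') + βV(x) = λ on ℝ. -/
def IsViscSol (a V G : ℝ → ℝ) (β lam : ℝ) (u : ℝ → ℝ) : Prop :=
  Continuous u ∧ IsViscSubsol a V G β lam u ∧ IsViscSupersol a V G β lam u

/-- The set 𝒮^λ_+ of Lipschitz viscosity solutions with
u'(x) ∈ [G_+^{-1}(λ−β), G_+^{-1}(λ)] for a.e. x ∈ ℝ. -/
def Splus (a V G : ℝ → ℝ) (β lam : ℝ) : Set (ℝ → ℝ) :=
  {u | (∃ K : NNReal, LipschitzWith K u) ∧ IsViscSol a V G β lam u ∧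
    ∀ᵐ x ∂(volume : Measure ℝ),
      deriv u x ∈ Set.Icc (GplusInv G (lam - β)) (GplusInv G lam)}

/-- The set 𝒮^λ_− of Lipschitz viscosity solutions with
u'(x) ∈ [G_−^{-1}(λ), G_−^{-1}(λ−β)] for a.e. x ∈ ℝ. -/
def Sminus (a V G : ℝ → ℝ) (β lam : ℝ) : Set (ℝ → ℝ) :=
  {u | (∃ K : NNReal, LipschitzWith K u) ∧ IsViscSol a V G β lam u ∧
    ∀ᵐ x ∂(volume : Measure ℝ),
      deriv u x ∈ Set.Icc (GminusInv G lam) (GminusInv G (lam - β))}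

open Filter Topology

lemma hasDerivAt_quadratic (A B C x : ℝ) :
    HasDerivAt (fun x : ℝ => A * x ^ 2 + B * x + C) (2 * A * x + B) x := by
  have h : HasDerivAt (fun x : ℝ => A * x ^ 2 + B * x + C) (A * (2 * x) + B * 1 + 0) x := by
    simpa using ((((hasDerivAt_id x).pow 2).const_mul A).add
      ((hasDerivAt_id x).const_mul B)).add_const C
  convert h using 1
  ring

lemma hasDerivAt_half_mul_sq (k x : ℝ) : HasDerivAt (fun x : ℝ => k / 2 * x ^ 2) (k * x) x := by
  have h := hasDerivAt_quadratic (k / 2) 0 0 x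
  simp only [zero_mul, add_zero] at h
  convert h using 1
  ring

lemma deriv_quadratic (A B C : ℝ) :
    deriv (fun x : ℝ => A * x ^ 2 + B * x + C) = fun x => 2 * A * x + B :=
  funext fun x => (hasDerivAt_quadratic A B C x).deriv

lemma deriv_deriv_quadratic (A B C : ℝ) (x : ℝ) :
    deriv (deriv (fun x : ℝ => A * x ^ 2 + B * x + C)) x = 2 * A := by
  rw [deriv_quadratic]
  have h : HasDerivAt (fun x : ℝ => 2 * A * x + B) (2 * A * 1) x :=
    ((hasDerivAt_id x).const_mul (2 * A)).add_const B
  rw [h.deriv, mul_one]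

lemma IsViscSubsol.quadratic_test {a V G u : ℝ → ℝ} {β lam : ℝ}
    (h : IsViscSubsol a V G β lam u) {x A B C : ℝ}
    (hx : IsLocalMax (fun y => u y - (A * y ^ 2 + B * y + C)) x) :
    lam ≤ a x * (2 * A) + G (2 * A * x + B) + β * V x := by
  have := h x (fun y => A * y ^ 2 + B * y + C) (by fun_prop) hx
  rwa [deriv_deriv_quadratic, deriv_quadratic] at this

lemma IsViscSupersol.neg {a V G u : ℝ → ℝ} {β lam : ℝ} (h : IsViscSupersol a V G β lam u) :
    IsViscSubsol a V (fun p => -G (-p)) (-β) (-lam) (fun x => -u x) := by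
  intro x φ hφ hx
  have hm : IsLocalMin (fun y => u y - (-φ) y) x := by
    refine hx.neg.congr (Eventually.of_forall fun y => ?_)
    simp only [Pi.neg_apply]
    ring
  have := h x (-φ) hφ.neg hm
  have h1 : deriv (-φ) = -deriv φ := by
    funext y
    exact deriv.neg
  have h2 : deriv (-deriv φ) x = -deriv (deriv φ) x := deriv.neg
  rw [h1, h2] at this
  simp only [Pi.neg_apply] at this
  linarith

/-- A continuous function whose touching parabolas from above have second derivative at least `m`
is convex up to the quadratic `m / 2 * x ^ 2`. -/
lemma convexOn_sub_quadratic_of_test {u : ℝ → ℝ} {c d m : ℝ} (hu : Continuous u)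
    (h : ∀ x ∈ Ioo c d, ∀ A B C : ℝ,
      IsLocalMax (fun y => u y - (A * y ^ 2 + B * y + C)) x → m ≤ 2 * A) :
    ConvexOn ℝ (Ioo c d) (fun x => u x - m / 2 * x ^ 2) := by
  refine LinearOrder.convexOn_of_lt (convex_Ioo c d) fun p hp q hq hpq s t hs ht hst => ?_
  by_contra! hlt
  simp only [smul_eq_mul] at hlt
  set f : ℝ → ℝ := fun x => u x - m / 2 * x ^ 2 with hf
  set z := s * p + t * q with hz
  have hqp : 0 < q - p := sub_pos.2 hpq
  have hzp : z - p = t * (q - p) := by rw [hz]; linear_combination p * hst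
  have hqz : q - z = s * (q - p) := by rw [hz]; linear_combination (-q) * hst
  set σ := (f q - f p) / (q - p) with hσ
  have hσq : σ * (q - p) = f q - f p := by rw [hσ]; field_simp
  set D := f z - (f p + σ * (z - p)) with hD
  have hDpos : 0 < D := by
    have : f p + σ * (z - p) = s * f p + t * f q := by
      rw [hzp]; linear_combination t * hσq - f p * hst
    rw [hD, this]; simp only [hf]; linarith
  have hzp0 : 0 < z - p := by rw [hzp]; positivity
  have hqz0 : 0 < q - z := by rw [hqz]; positivity
  set ε := D / (2 * ((z - p) * (q - z))) with hε
  have hε0 : 0 < ε := by positivity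
  have hεz : ε * ((z - p) * (q - z)) = D / 2 := by rw [hε]; field_simp
  set A := m / 2 - ε with hA
  set B := σ + ε * (p + q) with hB
  set C := f p - σ * p - ε * p * q with hC
  have key : ∀ y, u y - (A * y ^ 2 + B * y + C)
      = f y - (f p + σ * (y - p)) - ε * ((y - p) * (q - y)) := by
    intro y; simp only [hA, hB, hC, hf]; ring
  obtain ⟨x, hx, hmax⟩ := isCompact_Icc.exists_isMaxOn (s := Icc p q)
    ⟨z, by constructor <;> linarith⟩
    (f := fun y => u y - (A * y ^ 2 + B * y + C)) (by fun_prop)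
  have hxz : u z - (A * z ^ 2 + B * z + C) ≤ u x - (A * x ^ 2 + B * x + C) :=
    hmax (show z ∈ Icc p q by constructor <;> linarith)
  rw [key, key, hεz] at hxz
  have hxp : x ≠ p := by
    rintro rfl
    simp only [sub_self] at hxz
    linarith
  have hxq : x ≠ q := by
    rintro rfl
    rw [hσq] at hxz
    simp only [sub_self] at hxz
    linarith
  have hxp' : p < x := lt_of_le_of_ne hx.1 (Ne.symm hxp)
  have hxq' : x < q := lt_of_le_of_ne hx.2 hxq
  have := h x ⟨hp.1.trans hxp', hxq'.trans hq.2⟩ A B C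
    (hmax.isLocalMax (Icc_mem_nhds hxp' hxq'))
  simp only [hA] at this
  linarith

lemma differentiableAt_of_convexOn_of_convexOn {u : ℝ → ℝ} {c d m M x : ℝ}
    (h₁ : ConvexOn ℝ (Ioo c d) (fun x => u x - m / 2 * x ^ 2))
    (h₂ : ConvexOn ℝ (Ioo c d) (fun x => M / 2 * x ^ 2 - u x)) (hx : x ∈ Ioo c d) :
    DifferentiableAt ℝ u x := by
  have hxi : x ∈ interior (Ioo c d) := by rwa [interior_Ioo]
  have hsq : ∀ (k : ℝ) (s : Set ℝ), HasDerivWithinAt (fun x : ℝ => k / 2 * x ^ 2) (k * x) s x :=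
    fun k s => (hasDerivAt_half_mul_sq k x).hasDerivWithinAt
  have r₁ := (h₁.hasDerivWithinAt_rightDeriv_of_mem_interior hxi).add (hsq m _)
  have l₁ := (h₁.hasDerivWithinAt_leftDeriv_of_mem_interior hxi).add (hsq m _)
  have r₂ := (hsq M _).sub (h₂.hasDerivWithinAt_rightDeriv_of_mem_interior hxi)
  have l₂ := (hsq M _).sub (h₂.hasDerivWithinAt_leftDeriv_of_mem_interior hxi)
  have i₁ := h₁.leftDeriv_le_rightDeriv_of_mem_interior hxi
  have i₂ := h₂.leftDeriv_le_rightDeriv_of_mem_interior hxi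
  have e₁ : ((fun x => u x - m / 2 * x ^ 2) + fun x => m / 2 * x ^ 2) = u := by
    funext y; simp
  have e₂ : ((fun x => M / 2 * x ^ 2) - fun x => M / 2 * x ^ 2 - u x) = u := by
    funext y; simp
  rw [e₁] at r₁ l₁
  rw [e₂] at r₂ l₂
  have hr := (uniqueDiffWithinAt_Ioi x).eq_deriv _ r₁ r₂
  have hl := (uniqueDiffWithinAt_Iio x).eq_deriv _ l₁ l₂
  have heq : derivWithin (fun x => u x - m / 2 * x ^ 2) (Iio x) x
      = derivWithin (fun x => u x - m / 2 * x ^ 2) (Ioi x) x := by linarith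
  rw [heq] at l₁
  have := l₁.Iic_of_Iio.union r₁.Ici_of_Ioi
  rw [Iic_union_Ici, hasDerivWithinAt_univ] at this
  exact this.differentiableAt

lemma deriv_sub_mem_Icc_of_convexOn_of_convexOn {u : ℝ → ℝ} {c d m M x y : ℝ}
    (h₁ : ConvexOn ℝ (Ioo c d) (fun x => u x - m / 2 * x ^ 2))
    (h₂ : ConvexOn ℝ (Ioo c d) (fun x => M / 2 * x ^ 2 - u x)) (hx : x ∈ Ioo c d)
    (hy : y ∈ Ioo c d) (hxy : x ≤ y) :
    deriv u y - deriv u x ∈ Icc (m * (y - x)) (M * (y - x)) := by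
  have hd : ∀ z ∈ Ioo c d, DifferentiableAt ℝ u z := fun z hz =>
    differentiableAt_of_convexOn_of_convexOn h₁ h₂ hz
  have d₁ : ∀ z ∈ Ioo c d,
      HasDerivAt (fun x => u x - m / 2 * x ^ 2) (deriv u z - m * z) z := fun z hz =>
    (hd z hz).hasDerivAt.sub (hasDerivAt_half_mul_sq m z)
  have d₂ : ∀ z ∈ Ioo c d,
      HasDerivAt (fun x => M / 2 * x ^ 2 - u x) (M * z - deriv u z) z := fun z hz =>
    (hasDerivAt_half_mul_sq M z).sub (hd z hz).hasDerivAt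
  have m₁ := h₁.monotoneOn_deriv (fun z hz => (d₁ z hz).differentiableAt) hx hy hxy
  have m₂ := h₂.monotoneOn_deriv (fun z hz => (d₂ z hz).differentiableAt) hx hy hxy
  rw [(d₁ x hx).deriv, (d₁ y hy).deriv] at m₁
  rw [(d₂ x hx).deriv, (d₂ y hy).deriv] at m₂
  constructor <;> linarith

lemma abs_slope_le_of_isLocalMax {u : ℝ → ℝ} {K : NNReal} (hu : LipschitzWith K u)
    {x A B C : ℝ} (hx : IsLocalMax (fun y => u y - (A * y ^ 2 + B * y + C)) x) :
    |2 * A * x + B| ≤ K := by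
  obtain ⟨r, hr, hball⟩ := Metric.eventually_nhds_iff.1 hx
  have key : ∀ h : ℝ, |h| < r → -(K * |h|) ≤ h * (2 * A * x + B) + A * h ^ 2 := by
    intro h hh
    have h1 := hball (y := x + h) (by simpa [Real.dist_eq] using hh)
    have h2 := hu.dist_le_mul (x + h) x
    rw [Real.dist_eq, Real.dist_eq, add_sub_cancel_left] at h2
    have h3 := (abs_le.1 h2).1
    simp only at h1
    nlinarith
  have lim : ∀ s : ℝ, |s| = 1 → -(K : ℝ) ≤ s * (2 * A * x + B) := by
    intro s hs
    by_contra! hlt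
    set g := -(K : ℝ) - s * (2 * A * x + B) with hg
    have hg0 : 0 < g := by rw [hg]; linarith
    set t := min (r / 2) (g / (2 * (|A| + 1))) with ht
    have hA : 0 < |A| + 1 := by positivity
    have ht0 : 0 < t := by positivity
    have ht1 : t ≤ r / 2 := min_le_left _ _
    have ht2 : t * (2 * (|A| + 1)) ≤ g := (le_div_iff₀ (by positivity)).1 (min_le_right _ _)
    have hk := key (s * t) (by rw [abs_mul, hs, one_mul, abs_of_pos ht0]; linarith)
    rw [abs_mul, hs, one_mul, abs_of_pos ht0] at hk
    have hs2 : s ^ 2 = 1 := by rw [← sq_abs, hs, one_pow]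
    have h5 : -((K : ℝ) * t) ≤ t * (s * (2 * A * x + B) + A * t) := by
      calc -((K : ℝ) * t) ≤ _ := hk
        _ = t * (s * (2 * A * x + B)) + A * (s ^ 2 * t ^ 2) := by ring
        _ = _ := by rw [hs2]; ring
    have h6 : -(K : ℝ) ≤ s * (2 * A * x + B) + A * t := by
      by_contra! h7
      nlinarith
    have h8 : A * t ≤ |A| * t := mul_le_mul_of_nonneg_right (le_abs_self A) ht0.le
    nlinarith
  have h1 := lim 1 (by simp)
  have h2 := lim (-1) (by simp)
  exact abs_le.2 ⟨by linarith, by linarith⟩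

lemma exists_convexOn_of_eventually_test {u Φ : ℝ → ℝ} {x₀ m : ℝ} (hu : Continuous u)
    (hΦ : ContinuousAt Φ x₀) (hm : m < Φ x₀)
    (h : ∀ᶠ y in 𝓝 x₀, ∀ A B C : ℝ,
      IsLocalMax (fun z => u z - (A * z ^ 2 + B * z + C)) y → Φ y ≤ 2 * A) :
    ∃ r > 0, ∀ s ≤ r, ConvexOn ℝ (Ioo (x₀ - s) (x₀ + s)) (fun x => u x - m / 2 * x ^ 2) := by
  obtain ⟨r, hr, hball⟩ := Metric.eventually_nhds_iff.1 (h.and (hΦ.eventually_const_lt hm))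
  refine ⟨r, hr, fun s hs => convexOn_sub_quadratic_of_test hu fun x hx A B C hmax => ?_⟩
  have := hball (y := x) (by rw [Real.dist_eq, abs_lt]; constructor <;> linarith [hx.1, hx.2])
  exact this.2.le.trans (this.1 A B C hmax)

section Regularity

variable {a V G u : ℝ → ℝ} {β lam x₀ : ℝ}

lemma IsViscSubsol.exists_convexOn (h : IsViscSubsol a V G β lam u) {K : NNReal}
    (hu : LipschitzWith K u) (ha : Continuous a) (hV : Continuous V) (hG : Continuous G)
    (hx₀ : 0 < a x₀) :
    ∃ m : ℝ, ∃ r > 0, ∀ s ≤ r,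
      ConvexOn ℝ (Ioo (x₀ - s) (x₀ + s)) (fun x => u x - m / 2 * x ^ 2) := by
  obtain ⟨M, hM⟩ := (isCompact_Icc (a := -(K : ℝ)) (b := K)).bddAbove_image hG.continuousOn
  set Φ : ℝ → ℝ := fun y => (lam - M - β * V y) / a y
  have hΦ : ContinuousAt Φ x₀ := by
    apply ContinuousAt.div _ ha.continuousAt hx₀.ne'
    fun_prop
  refine ⟨Φ x₀ - 1, exists_convexOn_of_eventually_test hu.continuous hΦ (by linarith) ?_⟩
  filter_upwards [ha.continuousAt.eventually_const_lt hx₀] with y hy A B C hmax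
  have h1 := h.quadratic_test hmax
  have h2 : G (2 * A * y + B) ≤ M :=
    hM (mem_image_of_mem G (abs_le.1 (abs_slope_le_of_isLocalMax hu hmax)))
  rw [div_le_iff₀ hy]
  linarith

lemma IsViscSubsol.exists_convexOn_of_continuousAt_deriv (h : IsViscSubsol a V G β lam u)
    (hu : Continuous u) (ha : Continuous a) (hV : Continuous V) (hG : Continuous G)
    (hx₀ : 0 < a x₀) (hd : ∀ᶠ y in 𝓝 x₀, DifferentiableAt ℝ u y)
    (hc : ContinuousAt (deriv u) x₀) {m : ℝ}
    (hm : m < (lam - β * V x₀ - G (deriv u x₀)) / a x₀) :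
    ∃ r > 0, ∀ s ≤ r,
      ConvexOn ℝ (Ioo (x₀ - s) (x₀ + s)) (fun x => u x - m / 2 * x ^ 2) := by
  refine exists_convexOn_of_eventually_test
    (Φ := fun y => (lam - β * V y - G (deriv u y)) / a y) hu ?_ hm ?_
  · apply ContinuousAt.div _ ha.continuousAt hx₀.ne'
    have := hG.continuousAt.comp hc
    exact (continuousAt_const.sub (continuousAt_const.mul hV.continuousAt)).sub this
  · filter_upwards [ha.continuousAt.eventually_const_lt hx₀, hd] with y hy hdy A B C hmax
    have h1 := h.quadratic_test hmax
    have h3 := hmax.hasDerivAt_eq_zero (hdy.hasDerivAt.sub (hasDerivAt_quadratic A B C y))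
    rw [← sub_eq_zero.1 h3] at h1
    rw [div_le_iff₀ hy]
    linarith

lemma ConvexOn.congr_neg_neg {s : Set ℝ} {m : ℝ}
    (h : ConvexOn ℝ s (fun x => -u x - m / 2 * x ^ 2)) :
    ConvexOn ℝ s (fun x => -m / 2 * x ^ 2 - u x) := by
  convert h using 2
  ring

/-- Where the diffusion coefficient is positive, Lipschitz viscosity solutions are differentiable
near the given point. -/
lemma IsViscSol.eventually_differentiableAt (h : IsViscSol a V G β lam u) {K : NNReal}
    (hu : LipschitzWith K u) (ha : Continuous a) (hV : Continuous V) (hG : Continuous G)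
    (hx₀ : 0 < a x₀) :
    (∀ᶠ y in 𝓝 x₀, DifferentiableAt ℝ u y) ∧ ContinuousAt (deriv u) x₀ := by
  obtain ⟨m, r₁, hr₁, h₁⟩ := h.2.1.exists_convexOn hu ha hV hG hx₀
  obtain ⟨M, r₂, hr₂, h₂⟩ := h.2.2.neg.exists_convexOn hu.neg ha hV (by fun_prop) hx₀
  set r := min r₁ r₂
  have hr : 0 < r := lt_min hr₁ hr₂
  have c₁ := h₁ r (min_le_left _ _)
  have c₂ := (h₂ r (min_le_right _ _)).congr_neg_neg
  have hnhds : Ioo (x₀ - r) (x₀ + r) ∈ 𝓝 x₀ := Ioo_mem_nhds (by linarith) (by linarith)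
  have hx₀r : x₀ ∈ Ioo (x₀ - r) (x₀ + r) := ⟨by linarith, by linarith⟩
  refine ⟨?_, ?_⟩
  · filter_upwards [hnhds] with y hy using differentiableAt_of_convexOn_of_convexOn c₁ c₂ hy
  · rw [Metric.continuousAt_iff']
    intro ε hε
    have hlim : Tendsto (fun y => (|m| + |M|) * |y - x₀|) (𝓝 x₀) (𝓝 0) := by
      have : Continuous (fun y => (|m| + |M|) * |y - x₀|) := by fun_prop
      simpa using this.tendsto x₀
    filter_upwards [hnhds, hlim.eventually_lt_const hε] with y hy hlt
    refine lt_of_le_of_lt ?_ hlt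
    have hb : ∀ k t : ℝ, |k| ≤ |m| + |M| → |k * t| ≤ (|m| + |M|) * |t| := fun k t hk => by
      rw [abs_mul]; gcongr
    have hm := hb m (y - x₀) (by linarith [abs_nonneg M])
    have hM := hb (-M) (y - x₀) (by rw [abs_neg]; linarith [abs_nonneg m])
    rw [abs_le] at hm hM
    rw [Real.dist_eq, abs_le]
    rcases le_total x₀ y with hxy | hxy
    · have := deriv_sub_mem_Icc_of_convexOn_of_convexOn c₁ c₂ hx₀r hy hxy
      constructor <;> linarith [this.1, this.2]
    · have := deriv_sub_mem_Icc_of_convexOn_of_convexOn c₁ c₂ hy hx₀r hxy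
      constructor <;> linarith [this.1, this.2]

/-- Where the diffusion coefficient is positive, Lipschitz viscosity solutions are classical. -/
lemma IsViscSol.hasDerivAt_deriv (h : IsViscSol a V G β lam u) {K : NNReal}
    (hu : LipschitzWith K u) (ha : Continuous a) (hV : Continuous V) (hG : Continuous G)
    (hx₀ : 0 < a x₀) :
    HasDerivAt (deriv u) ((lam - β * V x₀ - G (deriv u x₀)) / a x₀) x₀ := by
  obtain ⟨hd, hc⟩ := h.eventually_differentiableAt hu ha hV hG hx₀
  set F := (lam - β * V x₀ - G (deriv u x₀)) / a x₀ with hF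
  have hdn : deriv (fun x => -u x) = fun x => -deriv u x := by
    funext y
    exact deriv.fun_neg
  rw [hasDerivAt_iff_isLittleO, Asymptotics.isLittleO_iff]
  intro ε hε
  obtain ⟨r₁, hr₁, h₁⟩ := h.2.1.exists_convexOn_of_continuousAt_deriv hu.continuous ha hV hG hx₀
    hd hc (m := F - ε) (by linarith)
  obtain ⟨r₂, hr₂, h₂⟩ := h.2.2.neg.exists_convexOn_of_continuousAt_deriv hu.continuous.neg ha hV
    (by fun_prop) hx₀ (hd.mono fun y hy => hy.neg) (by rw [hdn]; exact hc.neg) (m := -F - ε) (by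
      have : (-lam - -β * V x₀ - -G (-deriv (fun x => -u x) x₀)) / a x₀ = -F := by
        rw [hdn, hF, ← neg_div, neg_neg]; ring
      rw [this]; linarith)
  set r := min r₁ r₂
  have hr : 0 < r := lt_min hr₁ hr₂
  have c₁ := h₁ r (min_le_left _ _)
  have c₂ := (h₂ r (min_le_right _ _)).congr_neg_neg
  have hx₀r : x₀ ∈ Ioo (x₀ - r) (x₀ + r) := ⟨by linarith, by linarith⟩
  filter_upwards [Ioo_mem_nhds hx₀r.1 hx₀r.2] with y hy
  simp only [smul_eq_mul, Real.norm_eq_abs]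
  rcases le_total x₀ y with hxy | hxy
  · have := deriv_sub_mem_Icc_of_convexOn_of_convexOn c₁ c₂ hx₀r hy hxy
    rw [abs_of_nonneg (sub_nonneg.2 hxy), abs_le]
    constructor <;> linarith [this.1, this.2]
  · have := deriv_sub_mem_Icc_of_convexOn_of_convexOn c₁ c₂ hy hx₀r hxy
    rw [abs_of_nonpos (sub_nonpos.2 hxy), abs_le]
    constructor <;> linarith [this.1, this.2]

end Regularity

section Degenerate

variable {a V G u : ℝ → ℝ} {β lam x₀ p : ℝ} {κ : NNReal}

lemma IsViscSubsol.le_of_hasDerivAt_of_eq_zero (h : IsViscSubsol a V G β lam u)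
    (hu : Continuous u) (ha : ∀ x, 0 ≤ a x) (hκ : LipschitzWith κ fun x => √(a x))
    (hV : Continuous V) (hG : Continuous G) (hx₀ : a x₀ = 0) (hp : HasDerivAt u p x₀) :
    lam ≤ G p + β * V x₀ := by
  by_contra! hlt
  have hcont : Continuous fun w : ℝ × ℝ × ℝ => w.1 + G w.2.1 + β * V w.2.2 := by fun_prop
  have hev : ∀ᶠ w : ℝ × ℝ × ℝ in 𝓝 (0, p, x₀), w.1 + G w.2.1 + β * V w.2.2 < lam :=
    hcont.continuousAt.eventually_lt_const (by simpa using hlt)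
  obtain ⟨δ, hδ, hball⟩ := Metric.eventually_nhds_iff.1 hev
  set ε := δ / 4 with hε
  have hε0 : 0 < ε := by positivity
  have hlo := (hasDerivAt_iff_isLittleO.1 hp).def (c := ε / 2) (by positivity)
  obtain ⟨r₁, hr₁, hu₁⟩ := Metric.eventually_nhds_iff.1 hlo
  set r := min (r₁ / 2) (min (δ / 2) (1 / ((κ : ℝ) ^ 2 + 1))) with hr
  have hr0 : 0 < r := by positivity
  have hrr₁ : r < r₁ := (min_le_left _ _).trans_lt (by linarith)
  have hrδ : r < δ := ((min_le_right _ _).trans (min_le_left _ _)).trans_lt (by linarith)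
  have hrκ : r * ((κ : ℝ) ^ 2 + 1) ≤ 1 :=
    (le_div_iff₀ (by positivity)).1 ((min_le_right _ _).trans (min_le_right _ _))
  set A := ε / r with hA
  have hA0 : 0 < A := by positivity
  have hAr : A * r = ε := by rw [hA]; field_simp
  have key : ∀ y, u y - (A * y ^ 2 + (p - 2 * A * x₀) * y + A * x₀ ^ 2)
      = u y - p * y - A * (y - x₀) ^ 2 := fun y => by ring
  obtain ⟨x, hx, hmax⟩ := isCompact_Icc.exists_isMaxOn (s := Icc (x₀ - r) (x₀ + r))
    ⟨x₀, by constructor <;> linarith⟩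
    (f := fun y => u y - (A * y ^ 2 + (p - 2 * A * x₀) * y + A * x₀ ^ 2)) (by fun_prop)
  have hle : u x₀ - (A * x₀ ^ 2 + (p - 2 * A * x₀) * x₀ + A * x₀ ^ 2)
      ≤ u x - (A * x ^ 2 + (p - 2 * A * x₀) * x + A * x₀ ^ 2) :=
    hmax (show x₀ ∈ Icc (x₀ - r) (x₀ + r) by constructor <;> linarith)
  rw [key, key] at hle
  have hxr : |x - x₀| ≤ r := abs_le.2 ⟨by linarith [hx.1], by linarith [hx.2]⟩
  have hux := hu₁ (y := x) (by rw [Real.dist_eq]; linarith)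
  simp only [smul_eq_mul, Real.norm_eq_abs] at hux
  have hux' := (abs_le.1 hux).2
  have hlt_r : |x - x₀| < r := by
    refine lt_of_le_of_ne hxr fun heq => ?_
    have h1 : A * (x - x₀) ^ 2 = ε * r := by rw [← sq_abs, heq, ← hAr]; ring
    rw [heq] at hux'
    have : 0 < ε * r := by positivity
    nlinarith
  rw [abs_lt] at hlt_r
  have htest := h.quadratic_test
    (hmax.isLocalMax (Icc_mem_nhds (by linarith) (by linarith)))
  have hsqrt : √(a x) ≤ κ * |x - x₀| := by
    have := hκ.dist_le_mul x x₀
    rw [hx₀, Real.sqrt_zero, Real.dist_eq, Real.dist_eq, sub_zero] at this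
    exact (le_abs_self _).trans this
  have hax : a x ≤ (κ : ℝ) ^ 2 * r ^ 2 := by
    rw [← Real.sq_sqrt (ha x), ← mul_pow]
    gcongr
    exact hsqrt.trans (by gcongr)
  have haA : a x * (2 * A) ≤ δ / 2 := by
    calc a x * (2 * A) ≤ (κ : ℝ) ^ 2 * r ^ 2 * (2 * A) := by gcongr
      _ = 2 * ε * (r * (κ : ℝ) ^ 2) := by rw [← hAr]; ring
      _ ≤ 2 * ε * 1 := by gcongr; linarith
      _ = δ / 2 := by rw [hε]; ring
  have haA0 : 0 ≤ a x * (2 * A) := mul_nonneg (ha x) (by positivity)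
  have hslope : |2 * A * (x - x₀)| < δ := by
    rw [abs_mul, abs_of_pos (by positivity : 0 < 2 * A)]
    calc 2 * A * |x - x₀| ≤ 2 * A * r := by gcongr
      _ = δ / 2 := by rw [mul_assoc, hAr, hε]; ring
      _ < δ := by linarith
  have := hball (y := (a x * (2 * A), 2 * A * x + (p - 2 * A * x₀), x)) (by
    simp only [Prod.dist_eq, Real.dist_eq, sub_zero, max_lt_iff]
    refine ⟨by rw [abs_of_nonneg haA0]; linarith, ?_, abs_lt.2 ⟨by linarith, by linarith⟩⟩
    rwa [show 2 * A * x + (p - 2 * A * x₀) - p = 2 * A * (x - x₀) by ring])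
  simp only at this
  linarith

/-- At a point where the diffusion coefficient vanishes and the solution is differentiable, the
first-order equation holds classically. -/
lemma IsViscSol.eq_of_hasDerivAt_of_eq_zero (h : IsViscSol a V G β lam u)
    (ha : ∀ x, 0 ≤ a x) (hκ : LipschitzWith κ fun x => √(a x))
    (hV : Continuous V) (hG : Continuous G) (hx₀ : a x₀ = 0) (hp : HasDerivAt u p x₀) :
    G p + β * V x₀ = lam := by
  have h1 := h.2.1.le_of_hasDerivAt_of_eq_zero h.1 ha hκ hV hG hx₀ hp
  have h2 := h.2.2.neg.le_of_hasDerivAt_of_eq_zero h.1.neg ha hκ hV (by fun_prop) hx₀ hp.neg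
  rw [neg_neg] at h2
  linarith

end Degenerate

/-- A function bounded above which decreases at rate at least `c / a` on `{a > 0}` above the level
`z₀` stays below that level, because the degeneracy of `a` makes `1 / a` non-integrable. -/
lemma lt_of_hasDerivAt_of_mul_le {a z z' : ℝ → ℝ} {κ c z₀ B : ℝ} (hκ : 0 < κ)
    (ha : ∀ x, a x ∈ Icc (0 : ℝ) 1) (hlip : LipschitzWith κ.toNNReal fun x => √(a x))
    (hc : 0 < c) (hz : ∀ x, 0 < a x → HasDerivAt z (z' x) x)
    (hz' : ∀ x, 0 < a x → z₀ ≤ z x → z' x * a x ≤ -c) (hB : ∀ x, 0 < a x → z x ≤ B)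
    {x : ℝ} (hx : 0 < a x) : z x < z₀ := by
  by_contra! hzx
  have step : ∀ y, 0 < a y → z₀ ≤ z y → ∃ w, 0 < a w ∧ z y + c / (8 * κ) ≤ z w := by
    intro y hy hzy
    set s := √(a y) with hs
    have hs0 : 0 < s := Real.sqrt_pos.2 hy
    have hs1 : s ≤ 1 := Real.sqrt_le_one.2 (ha y).2
    set L := s / (2 * κ) with hL
    have hL0 : 0 < L := by positivity
    have hκL : κ * L = s / 2 := by rw [hL]; field_simp
    set ρ := c / (4 * s ^ 2) with hρ
    have hρ0 : 0 < ρ := by positivity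
    have near : ∀ t ∈ Icc 0 L, 0 < a (y - t) ∧ a (y - t) < 4 * s ^ 2 := by
      intro t ht
      have h1 := hlip.dist_le_mul (y - t) y
      rw [Real.dist_eq, Real.dist_eq, Real.coe_toNNReal _ hκ.le, sub_sub_cancel_left, abs_neg,
        abs_of_nonneg ht.1, ← hs] at h1
      have h2 : κ * t ≤ s / 2 := by rw [← hκL]; gcongr; exact ht.2
      have h3 := abs_le.1 (h1.trans h2)
      have h4 : 0 < √(a (y - t)) := by linarith [h3.1]
      refine ⟨Real.sqrt_pos.1 h4, ?_⟩
      rw [← Real.sq_sqrt (ha (y - t)).1]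
      nlinarith [h3.2]
    have hd : ∀ t ∈ Icc 0 L, HasDerivAt (fun t => -z (y - t)) (z' (y - t)) t := by
      intro t ht
      have h1 := (hz _ (near t ht).1).comp t ((hasDerivAt_id t).const_sub y)
      have h2 := h1.neg
      rw [mul_neg_one, neg_neg] at h2
      exact h2
    have hfence := image_le_of_deriv_right_lt_deriv_boundary (a := 0) (b := L)
      (f := fun t => -z (y - t)) (f' := fun t => z' (y - t))
      (B := fun t => -z y - ρ * t) (B' := fun _ => -ρ)
      (fun t ht => (hd t ht).continuousAt.continuousWithinAt)
      (fun t ht => (hd t (Ico_subset_Icc_self ht)).hasDerivWithinAt)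
      (by simp)
      (fun t => by simpa using ((hasDerivAt_id t).const_mul ρ).const_sub (-z y))
      (fun t ht heq => by
        have hn := near t (Ico_subset_Icc_self ht)
        have h1 : z₀ ≤ z (y - t) := by
          have : 0 ≤ ρ * t := mul_nonneg hρ0.le ht.1
          linarith
        have h2 := hz' _ hn.1 h1
        have h3 : ρ * (4 * s ^ 2) = c := by rw [hρ]; field_simp
        by_contra! h4
        nlinarith [mul_le_mul_of_nonneg_right h4 hn.1.le, mul_lt_mul_of_pos_left hn.2 hρ0])
      (right_mem_Icc.2 hL0.le)
    refine ⟨y - L, (near L (right_mem_Icc.2 hL0.le)).1, ?_⟩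
    have h5 : c / (8 * κ) ≤ ρ * L := by
      have : ρ * L = c / (8 * κ) / s := by rw [hρ, hL]; field_simp; norm_num
      rw [this, le_div_iff₀ hs0]
      exact mul_le_of_le_one_right (by positivity) hs1
    linarith
  have hd0 : 0 < c / (8 * κ) := by positivity
  have iter : ∀ n : ℕ, ∃ w, 0 < a w ∧ z₀ + n * (c / (8 * κ)) ≤ z w := by
    intro n
    induction n with
    | zero => exact ⟨x, hx, by simpa using hzx⟩
    | succ n ih =>
      obtain ⟨w, hw, hzw⟩ := ih
      have : 0 ≤ n * (c / (8 * κ)) := by positivity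
      obtain ⟨v, hv, hzv⟩ := step w hw (by linarith)
      refine ⟨v, hv, ?_⟩
      push_cast
      linarith
  obtain ⟨n, hn⟩ := exists_nat_gt ((B - z₀) / (c / (8 * κ)))
  obtain ⟨w, hw, hzw⟩ := iter n
  rw [div_lt_iff₀ hd0] at hn
  linarith [hB w hw]

/-- Comparison of the derivatives of nondecreasing Lipschitz viscosity solutions at two levels. -/
theorem ae_deriv_sub_mem_Icc {a V G u₁ u₂ : ℝ → ℝ} {κ β lam₁ lam₂ R CR η : ℝ} (hκ : 0 < κ)
    (ha : ∀ x, a x ∈ Icc (0 : ℝ) 1) (hlip : LipschitzWith κ.toNNReal fun x => √(a x))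
    (hV : Continuous V) (hG : Continuous G) (hη : 0 < η) (hCR : 0 < CR)
    (hGη : ∀ p q, 0 ≤ p → p < q → η * (q - p) ≤ G q - G p)
    (hGC : ∀ p q, 0 ≤ p → p ≤ q → q ≤ R → G q - G p ≤ CR * (q - p))
    (hlam : lam₁ < lam₂) {K₁ K₂ : NNReal} (hK₁ : LipschitzWith K₁ u₁) (hK₂ : LipschitzWith K₂ u₂)
    (h₁ : IsViscSol a V G β lam₁ u₁) (h₂ : IsViscSol a V G β lam₂ u₂)
    (hd₁ : ∀ᵐ x, deriv u₁ x ∈ Icc 0 R) (hd₂ : ∀ᵐ x, deriv u₂ x ∈ Icc 0 R) :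
    ∀ᵐ x, (lam₂ - lam₁) / CR ≤ deriv u₂ x - deriv u₁ x ∧
      deriv u₂ x - deriv u₁ x ≤ (lam₂ - lam₁) / η := by
  have hac : Continuous a := by
    have : a = fun x => √(a x) ^ 2 := funext fun x => (Real.sq_sqrt (ha x).1).symm
    rw [this]
    exact hlip.continuous.pow 2
  have hrange : ∀ {u : ℝ → ℝ} {lam : ℝ} {K : NNReal}, LipschitzWith K u →
      IsViscSol a V G β lam u → (∀ᵐ x, deriv u x ∈ Icc 0 R) →
      ∀ x, 0 < a x → deriv u x ∈ Icc 0 R := by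
    intro u lam K hK hu hd x hx
    by_contra hn
    have hev := (hu.hasDerivAt_deriv hK hac hV hG hx).continuousAt.eventually
      (isClosed_Icc.isOpen_compl.mem_nhds hn)
    obtain ⟨y, hy, hy'⟩ := mem_closure_iff_nhds.1 (Measure.dense_of_ae hd x) _ hev
    exact hy hy'
  have r₁ := hrange hK₁ h₁ hd₁
  have r₂ := hrange hK₂ h₂ hd₂
  have hderiv : ∀ x, 0 < a x → HasDerivAt (fun x => deriv u₂ x - deriv u₁ x)
      ((lam₂ - lam₁ - (G (deriv u₂ x) - G (deriv u₁ x))) / a x) x := by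
    intro x hx
    have e : (lam₂ - lam₁ - (G (deriv u₂ x) - G (deriv u₁ x))) / a x =
        (lam₂ - β * V x - G (deriv u₂ x)) / a x - (lam₁ - β * V x - G (deriv u₁ x)) / a x := by
      ring
    rw [e]
    exact (h₂.hasDerivAt_deriv hK₂ hac hV hG hx).sub (h₁.hasDerivAt_deriv hK₁ hac hV hG hx)
  have hupper : ∀ x, 0 < a x → deriv u₂ x - deriv u₁ x ≤ (lam₂ - lam₁) / η := by
    intro x hx
    by_contra! hlt
    rw [div_lt_iff₀ hη] at hlt
    refine lt_irrefl _ (lt_of_hasDerivAt_of_mul_le hκ ha hlip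
      (c := (deriv u₂ x - deriv u₁ x) * η - (lam₂ - lam₁)) (by linarith) hderiv
      (fun y hy hle => ?_) (B := R)
      (fun y hy => by linarith [(r₂ y hy).2, (r₁ y hy).1]) hx)
    rw [div_mul_cancel₀ _ hy.ne']
    have hpos : 0 < deriv u₂ y - deriv u₁ y := by nlinarith
    have := hGη _ _ (r₁ y hy).1 (sub_pos.1 hpos)
    nlinarith
  have hlower : ∀ x, 0 < a x → (lam₂ - lam₁) / CR ≤ deriv u₂ x - deriv u₁ x := by
    intro x hx
    by_contra! hlt
    rw [lt_div_iff₀ hCR] at hlt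
    set w := deriv u₂ x - deriv u₁ x
    refine lt_irrefl _ (lt_of_hasDerivAt_of_mul_le hκ ha hlip
      (c := lam₂ - lam₁ - max (w * CR) 0) (sub_pos.2 (max_lt hlt (sub_pos.2 hlam)))
      (fun y hy => (hderiv y hy).neg) (fun y hy hle => ?_) (B := R)
      (fun y hy => ?_) hx)
    · rw [neg_mul, div_mul_cancel₀ _ hy.ne']
      have hle' : deriv u₂ y - deriv u₁ y ≤ w := neg_le_neg_iff.1 hle
      rcases le_or_gt (deriv u₁ y) (deriv u₂ y) with h | h
      · have := hGC _ _ (r₁ y hy).1 h (r₂ y hy).2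
        nlinarith [le_max_left (w * CR) 0]
      · have := hGη _ _ (r₂ y hy).1 h
        nlinarith [le_max_right (w * CR) 0]
    · show -(deriv u₂ y - deriv u₁ y) ≤ R
      linarith [(r₁ y hy).2, (r₂ y hy).1]
  filter_upwards [hd₁, hd₂, hK₁.ae_differentiableAt, hK₂.ae_differentiableAt]
    with x hx₁ hx₂ hdx₁ hdx₂
  rcases (ha x).1.lt_or_eq with hx | hx
  · exact ⟨hlower x hx, hupper x hx⟩
  · have e₁ := h₁.eq_of_hasDerivAt_of_eq_zero (fun y => (ha y).1) hlip hV hG hx.symm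
      hdx₁.hasDerivAt
    have e₂ := h₂.eq_of_hasDerivAt_of_eq_zero (fun y => (ha y).1) hlip hV hG hx.symm
      hdx₂.hasDerivAt
    have hlt : deriv u₁ x < deriv u₂ x := by
      by_contra! hge
      rcases hge.lt_or_eq with h | h
      · have := hGη _ _ hx₂.1 h
        nlinarith
      · rw [h] at e₂
        linarith
    have i₁ := hGη _ _ hx₁.1 hlt
    have i₂ := hGC _ _ hx₁.1 hlt.le hx₂.2
    rw [div_le_iff₀ hCR, le_div_iff₀ hη]
    constructor <;> linarith

lemma deriv_reflect (u : ℝ → ℝ) : deriv (fun x => u (-x)) = fun x => -deriv u (-x) :=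
  funext fun x => deriv_comp_neg u x

lemma deriv_deriv_reflect (u : ℝ → ℝ) (x : ℝ) :
    deriv (deriv fun x => u (-x)) x = deriv (deriv u) (-x) := by
  rw [deriv_reflect, deriv.fun_neg, deriv_comp_neg, neg_neg]

lemma IsViscSol.reflect {a V G u : ℝ → ℝ} {β lam : ℝ} (h : IsViscSol a V G β lam u) :
    IsViscSol (fun x => a (-x)) (fun x => V (-x)) (fun p => G (-p)) β lam (fun x => u (-x)) := by
  have htend : ∀ x : ℝ, Tendsto (fun y : ℝ => -y) (𝓝 (-x)) (𝓝 x) := fun x => by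
    simpa using (continuous_neg (G := ℝ)).tendsto (-x)
  refine ⟨h.1.comp continuous_neg, fun x φ hφ hx => ?_, fun x φ hφ hx => ?_⟩
  · have := h.2.1 (-x) (fun y => φ (-y)) (hφ.comp contDiff_neg) (by
      have h1 := (htend x).eventually hx
      simpa [IsLocalMax, IsMaxFilter] using h1)
    rw [deriv_deriv_reflect, deriv_reflect] at this
    simpa using this
  · have := h.2.2 (-x) (fun y => φ (-y)) (hφ.comp contDiff_neg) (by
      have h1 := (htend x).eventually hx
      simpa [IsLocalMin, IsMinFilter] using h1)
    rw [deriv_deriv_reflect, deriv_reflect] at this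
    simpa using this

lemma LipschitzWith.reflect {f : ℝ → ℝ} {K : NNReal} (h : LipschitzWith K f) :
    LipschitzWith K (fun x => f (-x)) := by
  simpa [Function.comp_def] using h.comp (LipschitzWith.id (α := ℝ)).neg

lemma ae_reflect {p : ℝ → Prop} (h : ∀ᵐ x, p x) : ∀ᵐ x, p (-x) :=
  (Measure.measurePreserving_neg (volume : Measure ℝ)).quasiMeasurePreserving.ae h

lemma MemGclass.continuous {G : ℝ → ℝ} (h : MemGclass G) : Continuous G := by
  obtain ⟨α₀, α₁, γ, -, hα₁, -, -, hG⟩ := h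
  rw [continuous_iff_continuousAt]
  intro p
  have hlim : Tendsto (fun q => α₁ * (|q| + |p| + 1) ^ (γ - 1) * |q - p|) (𝓝 p) (𝓝 0) := by
    have : Continuous fun q => α₁ * (|q| + |p| + 1) ^ (γ - 1) * |q - p| := by
      refine (continuous_const.mul (Continuous.rpow_const (by fun_prop) fun q => Or.inl ?_)).mul
        (by fun_prop)
      positivity
    simpa using this.tendsto p
  rw [ContinuousAt, tendsto_iff_dist_tendsto_zero]
  exact squeeze_zero (fun q => dist_nonneg) (fun q => hG q p) hlim

section HalfInverse

variable {G : ℝ → ℝ} {η : ℝ}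

lemma StrictIncrRate.reflect (h : StrictIncrRate G η) : StrictIncrRate (fun p => G (-p)) η :=
  fun p q hp hpq => ⟨(h p q hp hpq).2, by simpa using (h p q hp hpq).1⟩

lemma StrictIncrRate.gplusInv_spec (h : StrictIncrRate G η) (hη : 0 < η) (hG : Continuous G)
    (hG0 : G 0 = 0) {y : ℝ} (hy : 0 ≤ y) : 0 ≤ GplusInv G y ∧ G (GplusInv G y) = y := by
  have hex : ∃ p ∈ Ici (0 : ℝ), G p = y := by
    have hle : y ≤ G (y / η + 1) := by
      have := (h 0 (y / η + 1) le_rfl (by positivity)).1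
      have e : η * (y / η + 1 - 0) = y + η := by field_simp; ring
      rw [e, hG0] at this
      linarith
    obtain ⟨p, hp, hpy⟩ := intermediate_value_Icc (show (0 : ℝ) ≤ y / η + 1 by positivity)
      hG.continuousOn (show y ∈ Icc (G 0) (G (y / η + 1)) from ⟨by rwa [hG0], hle⟩)
    exact ⟨p, hp.1, hpy⟩
  exact ⟨Function.invFunOn_mem hex, Function.invFunOn_eq hex⟩

lemma StrictIncrRate.le_of_apply_le (h : StrictIncrRate G η) (hη : 0 < η) {p q : ℝ} (hq : 0 ≤ q)
    (hpq : G p ≤ G q) : p ≤ q := by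
  by_contra! hlt
  have := (h q p hq hlt).1
  nlinarith

lemma StrictIncrRate.gminusInv_eq (h : StrictIncrRate G η) (hη : 0 < η) (hG : Continuous G)
    (hG0 : G 0 = 0) {y : ℝ} (hy : 0 ≤ y) :
    GminusInv G y = -GplusInv (fun p => G (-p)) y := by
  obtain ⟨h1, h2⟩ := h.reflect.gplusInv_spec hη (by fun_prop) (by simpa using hG0) hy
  have hex : ∃ p ∈ Iic (0 : ℝ), G p = y := ⟨_, neg_nonpos.2 h1, h2⟩
  have h3 : GminusInv G y ≤ 0 := Function.invFunOn_mem hex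
  have h4 : G (GminusInv G y) = y := Function.invFunOn_eq hex
  have h5 : G (- -GminusInv G y) = G (-GplusInv (fun p => G (-p)) y) := by
    rw [neg_neg, h4, h2]
  have h6 := h.reflect.le_of_apply_le hη h1 h5.le
  have h7 := h.reflect.le_of_apply_le hη (neg_nonneg.2 h3) h5.ge
  linarith

end HalfInverse

/-- Comparison of the derivatives of elements of `Splus` at two levels. -/
theorem Splus.ae_deriv_sub_mem_Icc {a V G u₁ u₂ : ℝ → ℝ} {κ β lam₁ lam₂ R CR η : ℝ} (hκ : 0 < κ)
    (ha : ∀ x, a x ∈ Icc (0 : ℝ) 1) (hlip : LipschitzWith κ.toNNReal fun x => √(a x))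
    (hV : Continuous V) (hG : Continuous G) (hG0 : G 0 = 0) (hη : 0 < η)
    (hGη : StrictIncrRate G η) (hβ : 0 ≤ β) (hlam₁ : β ≤ lam₁) (hlam : lam₁ < lam₂)
    (hR : GplusInv G lam₂ ≤ R) (hCR : LipschitzOnWith CR.toNNReal G (Icc (-R) R))
    (h₁ : u₁ ∈ Splus a V G β lam₁) (h₂ : u₂ ∈ Splus a V G β lam₂) :
    ∀ᵐ x, (lam₂ - lam₁) / CR ≤ deriv u₂ x - deriv u₁ x ∧
      deriv u₂ x - deriv u₁ x ≤ (lam₂ - lam₁) / η := by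
  obtain ⟨⟨K₁, hK₁⟩, hv₁, hd₁⟩ := h₁
  obtain ⟨⟨K₂, hK₂⟩, hv₂, hd₂⟩ := h₂
  have s₂ := hGη.gplusInv_spec hη hG hG0 (hβ.trans (hlam₁.trans hlam.le))
  have s₁ := hGη.gplusInv_spec hη hG hG0 (hβ.trans hlam₁)
  have hmono : GplusInv G lam₁ ≤ GplusInv G lam₂ :=
    hGη.le_of_apply_le hη s₂.1 (by rw [s₁.2, s₂.2]; exact hlam.le)
  have hR0 : 0 < R := by
    refine lt_of_lt_of_le (lt_of_le_of_ne s₂.1 fun h => ?_) hR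
    have := s₂.2
    rw [← h, hG0] at this
    linarith
  have hdist : ∀ p q, 0 ≤ p → p ≤ q → q ≤ R → G q - G p ≤ CR.toNNReal * (q - p) := by
    intro p q hp hpq hq
    have := hCR.dist_le_mul q ⟨by linarith, hq⟩ p ⟨by linarith, by linarith⟩
    rw [Real.dist_eq, Real.dist_eq, abs_of_nonneg (sub_nonneg.2 hpq)] at this
    exact (le_abs_self _).trans this
  have hCR0 : 0 < CR := by
    by_contra! hle
    have h1 := hdist 0 R le_rfl hR0.le le_rfl
    have h2 := (hGη 0 R le_rfl hR0).1
    rw [Real.toNNReal_of_nonpos hle] at h1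
    simp only [NNReal.coe_zero, zero_mul, sub_zero] at h1 h2
    nlinarith
  rw [Real.coe_toNNReal _ hCR0.le] at hdist
  refine _root_.ae_deriv_sub_mem_Icc hκ ha hlip hV hG hη hCR0
    (fun p q hp hpq => (hGη p q hp hpq).1) hdist hlam hK₁ hK₂ hv₁ hv₂ ?_ ?_
  · have s := hGη.gplusInv_spec hη hG hG0 (sub_nonneg.2 hlam₁)
    filter_upwards [hd₁] with x hx using ⟨s.1.trans hx.1, hx.2.trans (hmono.trans hR)⟩
  · have s := hGη.gplusInv_spec hη hG hG0 (sub_nonneg.2 (hlam₁.trans hlam.le))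
    filter_upwards [hd₂] with x hx using ⟨s.1.trans hx.1, hx.2.trans hR⟩

/-- Reflecting the line exchanges `Sminus` and `Splus`. -/
lemma Sminus.reflect {a V G u : ℝ → ℝ} {β lam η : ℝ} (hG : Continuous G) (hG0 : G 0 = 0)
    (hη : 0 < η) (hGη : StrictIncrRate G η) (hβ : 0 ≤ β) (hlam : β ≤ lam)
    (h : u ∈ Sminus a V G β lam) :
    (fun x => u (-x)) ∈
      Splus (fun x => a (-x)) (fun x => V (-x)) (fun p => G (-p)) β lam := by
  obtain ⟨⟨K, hK⟩, hv, hd⟩ := h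
  refine ⟨⟨K, hK.reflect⟩, hv.reflect, ?_⟩
  rw [hGη.gminusInv_eq hη hG hG0 (hβ.trans hlam),
    hGη.gminusInv_eq hη hG hG0 (sub_nonneg.2 hlam)] at hd
  filter_upwards [ae_reflect hd] with x hx
  rw [deriv_reflect]
  exact ⟨le_neg_of_le_neg hx.2, neg_le_of_neg_le hx.1⟩

theorem derivative_comparison_between_levels
    {Ω : Type*} [MeasurableSpace Ω] (P : Measure Ω) [IsProbabilityMeasure P]
    (τ : ℝ → Ω → Ω)
    (hτ_meas : Measurable (fun p : ℝ × Ω => τ p.1 p.2))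
    (hτ_zero : ∀ ω, τ 0 ω = ω)
    (hτ_add : ∀ x y : ℝ, ∀ ω, τ (x + y) ω = τ x (τ y ω))
    (hτ_mp : ∀ x : ℝ, MeasurePreserving (τ x) P P)
    (hτ_erg : ∀ g : Ω → ℝ, Measurable g →
      (∀ x : ℝ, ∀ᵐ ω ∂P, g (τ x ω) = g ω) → ∃ c : ℝ, ∀ᵐ ω ∂P, g ω = c)
    (a V : ℝ → Ω → ℝ) (κ : ℝ) (hκ : 0 < κ)
    (ha_meas : Measurable (fun p : ℝ × Ω => a p.1 p.2))
    (hV_meas : Measurable (fun p : ℝ × Ω => V p.1 p.2))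
    (ha_range : ∀ x ω, a x ω ∈ Set.Icc (0 : ℝ) 1)
    (hV_range : ∀ x ω, V x ω ∈ Set.Icc (0 : ℝ) 1)
    (ha_lip : ∀ ω, LipschitzWith (Real.toNNReal κ) (fun x => Real.sqrt (a x ω)))
    (hV_lip : ∀ ω, LipschitzWith (Real.toNNReal κ) (fun x => V x ω))
    (ha_stat : ∀ x ω, a x ω = a 0 (τ x ω))
    (hV_stat : ∀ x ω, V x ω = V 0 (τ x ω))
    (β : ℝ) (hβ : 0 ≤ β)
    (G : ℝ → ℝ) (η : ℝ) (hη : 0 < η)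
    (hG : MemGsqc G) (hG_mono : StrictIncrRate G η)
    (lam₁ lam₂ : ℝ) (hlam₁ : β ≤ lam₁) (hlam₁₂ : lam₁ < lam₂)
    (R CR : ℝ)
    (hR : R = max (-(GminusInv G lam₂)) (GplusInv G lam₂))
    (hCR : LipschitzOnWith (Real.toNNReal CR) G (Set.Icc (-R) R))
    (up₁ up₂ um₁ um₂ : ℝ → Ω → ℝ)
    (hup₁ : ∀ ω, (fun x => up₁ x ω) ∈ Splus (fun x => a x ω) (fun x => V x ω) G β lam₁ ∧
      up₁ 0 ω = 0)
    (hup₂ : ∀ ω, (fun x => up₂ x ω) ∈ Splus (fun x => a x ω) (fun x => V x ω) G β lam₂ ∧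
      up₂ 0 ω = 0)
    (hum₁ : ∀ ω, (fun x => um₁ x ω) ∈ Sminus (fun x => a x ω) (fun x => V x ω) G β lam₁ ∧
      um₁ 0 ω = 0)
    (hum₂ : ∀ ω, (fun x => um₂ x ω) ∈ Sminus (fun x => a x ω) (fun x => V x ω) G β lam₂ ∧
      um₂ 0 ω = 0) :
    ∃ Ωhat : Set Ω, MeasurableSet Ωhat ∧ P Ωhat = 1 ∧
      ∀ ω ∈ Ωhat,
        (∀ᵐ x ∂(volume : Measure ℝ),
          (lam₂ - lam₁) / CR ≤ deriv (fun y => up₂ y ω) x - deriv (fun y => up₁ y ω) x ∧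
          deriv (fun y => up₂ y ω) x - deriv (fun y => up₁ y ω) x ≤ (lam₂ - lam₁) / η) ∧
        (∀ᵐ x ∂(volume : Measure ℝ),
          (lam₂ - lam₁) / CR ≤ deriv (fun y => um₁ y ω) x - deriv (fun y => um₂ y ω) x ∧
          deriv (fun y => um₁ y ω) x - deriv (fun y => um₂ y ω) x ≤ (lam₂ - lam₁) / η) := by
  have hGc := hG.1.continuous
  have hG0 := hG.2.1
  refine ⟨Set.univ, MeasurableSet.univ, measure_univ, fun ω _ => ⟨?_, ?_⟩⟩
  · exact Splus.ae_deriv_sub_mem_Icc hκ (fun x => ha_range x ω) (ha_lip ω) (hV_lip ω).continuous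
      hGc hG0 hη hG_mono hβ hlam₁ hlam₁₂ (hR ▸ le_max_right _ _) hCR (hup₁ ω).1 (hup₂ ω).1
  · have hR' : GplusInv (fun p => G (-p)) lam₂ ≤ R := by
      have := le_max_left (-(GminusInv G lam₂)) (GplusInv G lam₂)
      rwa [← hR, hG_mono.gminusInv_eq hη hGc hG0 (hβ.trans (hlam₁.trans hlam₁₂.le)),
        neg_neg] at this
    have hCR' : LipschitzOnWith CR.toNNReal (fun p => G (-p)) (Set.Icc (-R) R) := by
      refine LipschitzOnWith.of_dist_le_mul fun p hp q hq => ?_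
      rw [← dist_neg_neg p q]
      exact hCR.dist_le_mul _ ⟨neg_le_neg hp.2, neg_le.1 hp.1⟩ _ ⟨neg_le_neg hq.2, neg_le.1 hq.1⟩
    have hmain := Splus.ae_deriv_sub_mem_Icc hκ (fun x => ha_range (-x) ω) (ha_lip ω).reflect
      (hV_lip ω).reflect.continuous (hGc.comp continuous_neg) (by simpa using hG0) hη
      hG_mono.reflect hβ hlam₁ hlam₁₂ hR' hCR'
      (Sminus.reflect hGc hG0 hη hG_mono hβ hlam₁ (hum₁ ω).1)
      (Sminus.reflect hGc hG0 hη hG_mono hβ (hlam₁.trans hlam₁₂.le) (hum₂ ω).1)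
    filter_upwards [ae_reflect hmain] with x hx
    rw [deriv_reflect (fun y => um₁ y ω), deriv_reflect (fun y => um₂ y ω)] at hx
    simp only [neg_neg] at hx
    constructor <;> linarith [hx.1, hx.2]
end
end

section
/- Let a : ℝ → [0,∞), V : ℝ → ℝ, β ≥ 0, η > 0, λ₁ ≤ λ₂, and let G : ℝ → ℝ satisfy G(q) − G(p) ≥ η(q − p) for all q > p ≥ 0. Let f₁, f₂ : ℝ → [0,∞) be differentiable functions with a(x)fᵢ'(x) + G(fᵢ(x)) + βV(x) = λᵢ for all x ∈ ℝ (i = 1,2). If x₀ is a local maximum point of f₂ − f₁ and f₂(x₀) ≥ f₁(x₀), then f₂(x₀) − f₁(x₀) ≤ (λ₂ − λ₁)/η. -/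
open Real Set

theorem local_max_difference_bound
    (a V G : ℝ → ℝ) (β η lam₁ lam₂ : ℝ)
    (hβ : 0 ≤ β) (hη : 0 < η) (hlam : lam₁ ≤ lam₂)
    (ha_nonneg : ∀ x, 0 ≤ a x)
    (hG_mono : ∀ p q : ℝ, 0 ≤ p → p < q → η * (q - p) ≤ G q - G p)
    (f₁ f₂ : ℝ → ℝ)
    (hf₁_diff : Differentiable ℝ f₁) (hf₂_diff : Differentiable ℝ f₂)
    (hf₁_nonneg : ∀ x, 0 ≤ f₁ x) (hf₂_nonneg : ∀ x, 0 ≤ f₂ x)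
    (hf₁_ode : ∀ x, a x * deriv f₁ x + G (f₁ x) + β * V x = lam₁)
    (hf₂_ode : ∀ x, a x * deriv f₂ x + G (f₂ x) + β * V x = lam₂)
    (x₀ : ℝ) (hmax : IsLocalMax (fun x => f₂ x - f₁ x) x₀)
    (hge : f₁ x₀ ≤ f₂ x₀) :
    f₂ x₀ - f₁ x₀ ≤ (lam₂ - lam₁) / η := by
  have hderiv : deriv f₁ x₀ = deriv f₂ x₀ := by
    have h := hmax.hasDerivAt_eq_zero ((hf₂_diff x₀).hasDerivAt.sub (hf₁_diff x₀).hasDerivAt)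
    linarith
  have h₁ := hf₁_ode x₀
  have h₂ := hf₂_ode x₀
  rw [hderiv] at h₁
  rw [le_div_iff₀ hη]
  rcases hge.eq_or_lt with heq | hlt
  · rw [heq, sub_self, zero_mul]
    exact sub_nonneg.mpr hlam
  · linarith [hG_mono _ _ (hf₁_nonneg x₀) hlt]
end

section
/- Let a : ℝ → (0,1], V : ℝ → ℝ, β ≥ 0, η > 0, λ₁ < λ₂, and let G : ℝ → ℝ satisfy G(q) − G(p) ≥ η(q − p) for all q > p ≥ 0. Then there do not exist bounded differentiable functions f₁, f₂ : ℝ → [0,∞) such that a(x)f₁'(x) + G(f₁(x)) + βV(x) = λ₁ and a(x)f₂'(x) + G(f₂(x)) + βV(x) = λ₂ for all x ∈ ℝ and f₁(x) > f₂(x) for every x ∈ ℝ. -/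
open Real Set

theorem no_ordered_bounded_solutions_at_distinct_levels
    (a V G : ℝ → ℝ) (β η lam₁ lam₂ : ℝ)
    (hβ : 0 ≤ β) (hη : 0 < η) (hlam : lam₁ < lam₂)
    (ha_range : ∀ x, a x ∈ Set.Ioc (0 : ℝ) 1)
    (hG_mono : ∀ p q : ℝ, 0 ≤ p → p < q → η * (q - p) ≤ G q - G p) :
    ¬ ∃ f₁ f₂ : ℝ → ℝ,
      Differentiable ℝ f₁ ∧ Differentiable ℝ f₂ ∧
      (∀ x, 0 ≤ f₁ x) ∧ (∀ x, 0 ≤ f₂ x) ∧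
      (∃ M : ℝ, ∀ x, |f₁ x| ≤ M) ∧ (∃ M : ℝ, ∀ x, |f₂ x| ≤ M) ∧
      (∀ x, a x * deriv f₁ x + G (f₁ x) + β * V x = lam₁) ∧
      (∀ x, a x * deriv f₂ x + G (f₂ x) + β * V x = lam₂) ∧
      (∀ x, f₂ x < f₁ x) := by
  rintro ⟨f₁, f₂, hf₁, hf₂, -, hf₂_nonneg, -, -, heq₁, heq₂, hlt⟩
  have hc : 0 < lam₂ - lam₁ := sub_pos.2 hlam
  have hderiv : ∀ x, lam₂ - lam₁ ≤ deriv (fun t => f₂ t - f₁ t) x := by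
    intro x
    rw [deriv_fun_sub (hf₂ x) (hf₁ x)]
    obtain ⟨ha_pos, ha_le⟩ := ha_range x
    have hG := hG_mono _ _ (hf₂_nonneg x) (hlt x)
    have hgap : 0 < η * (f₁ x - f₂ x) := mul_pos hη (sub_pos.2 (hlt x))
    have hmul : lam₂ - lam₁ ≤ a x * (deriv f₂ x - deriv f₁ x) := by
      linarith [heq₁ x, heq₂ x]
    have hpos : 0 < deriv f₂ x - deriv f₁ x :=
      pos_of_mul_pos_right (hc.trans_le hmul) ha_pos.le
    exact hmul.trans (mul_le_of_le_one_left hpos.le ha_le)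
  have hgrowth := mul_sub_le_image_sub_of_le_deriv (hf₂.fun_sub hf₁) hderiv
    (div_pos (sub_pos.2 (hlt 0)) hc).le
  rw [sub_zero, mul_div_cancel₀ _ hc.ne'] at hgrowth
  linarith [hlt ((f₁ 0 - f₂ 0) / (lam₂ - lam₁))]
end
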